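/- arXiv:2509.00929 — 3 statements merged into one kernel-verified Lean document; each statement's English description precedes it below -/
import Mathlib

section
/- If G is a finite simple graph on n vertices which is 3K1-free and paraglider-free and 3·ω(G) < n, then n = 16 and ω(G) = 5. -/
open SimpleGraph

/-- The paraglider: a 4-cycle 0-1-2-3-0 plus a vertex 4 adjacent to 0, 1, 2. -/
def paraglider : SimpleGraph (Fin 5) :=
  SimpleGraph.fromEdgeSet {s(0,1), s(1,2), s(2,3), s(3,0), s(4,0), s(4,1), s(4,2)}

namespace SimpleGraph

variable {V : Type*} {H : SimpleGraph V} {k : ℕ} {e : Fin k → Bool → V}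

/-- `H` has no triangle. -/
def NoTriangle (H : SimpleGraph V) : Prop :=
  ∀ ⦃a b c⦄, H.Adj a b → H.Adj a c → ¬H.Adj b c

/-- No edge `uv` of `H` is anticomplete to a path `a - w - b`. -/
def NoEdgeWithPath (H : SimpleGraph V) : Prop :=
  ∀ ⦃u v w a b⦄, H.Adj u v → H.Adj w a → H.Adj w b → a ≠ b →
    ¬H.Adj u w → ¬H.Adj u a → ¬H.Adj u b → ¬H.Adj v w → ¬H.Adj v a → ¬H.Adj v b → False

/-- The edges `e i false - e i true` form an induced matching of `H`. -/
def IsInducedMatching (H : SimpleGraph V) (e : Fin k → Bool → V) : Prop :=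
  ∀ i j b c, H.Adj (e i b) (e j c) ↔ i = j ∧ b ≠ c

/-- `t` is adjacent to exactly one end of every matching edge, selected by `s`. -/
def Attaches (H : SimpleGraph V) (e : Fin k → Bool → V) (t : V) (s : Fin k → Bool) : Prop :=
  ∀ j b, H.Adj t (e j b) ↔ s j = b

namespace IsInducedMatching

theorem eq_and_eq (he : H.IsInducedMatching e) {i j : Fin k} {b c : Bool}
    (h : e i b = e j c) : i = j ∧ b = c := by
  have h1 : H.Adj (e i b) (e i (!b)) := (he _ _ _ _).2 ⟨rfl, by simp⟩
  rw [h, he] at h1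
  obtain ⟨rfl, h2⟩ := h1
  exact ⟨rfl, by cases b <;> cases c <;> simp_all⟩

/-- A vertex outside the matching with a neighbour in it attaches to every edge of it. -/
theorem exists_attaches (he : H.IsInducedMatching e) (htri : H.NoTriangle)
    (hP : H.NoEdgeWithPath) {t : V} (ht : ∀ i b, t ≠ e i b) {i : Fin k} {b : Bool}
    (hadj : H.Adj t (e i b)) : ∃ s, H.Attaches e t s := by
  have key : ∀ j, ∃ c, H.Adj t (e j c) := by
    intro j
    by_contra! hj
    have hij : i ≠ j := by rintro rfl; exact hj b hadj
    refine hP (u := e j true) (v := e j false) (w := e i b) (a := t) (b := e i (!b))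
      ((he _ _ _ _).2 ⟨rfl, by simp⟩) hadj.symm ((he _ _ _ _).2 ⟨rfl, by simp⟩) (ht _ _)
      ?_ (fun h => hj _ h.symm) ?_ ?_ (fun h => hj _ h.symm) ?_ <;>
    · rw [he]; exact fun h => hij h.1.symm
  choose s hs using key
  refine ⟨s, fun j b => ⟨fun h => ?_, fun h => h ▸ hs j⟩⟩
  by_contra hne
  exact htri (hs j) h ((he _ _ _ _).2 ⟨rfl, hne⟩)

/-- Two adjacent vertices anticomplete to the matching extend it. -/
theorem extend (he : H.IsInducedMatching e) {o p : V} (hop : H.Adj o p)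
    (ho : ∀ i b, ¬H.Adj o (e i b)) (hp : ∀ i b, ¬H.Adj p (e i b)) :
    ∃ f : Fin (k + 1) → Bool → V, H.IsInducedMatching f := by
  refine ⟨Fin.cons (fun b => cond b o p) e, fun i j b c => ?_⟩
  have ho' := fun i b (h : H.Adj (e i b) o) => ho i b h.symm
  have hp' := fun i b (h : H.Adj (e i b) p) => hp i b h.symm
  refine Fin.cases ?_ (fun i => ?_) i <;> refine Fin.cases ?_ (fun j => ?_) j
  · cases b <;> cases c <;> simp [hop, hop.symm]
  · cases b <;> simp [ho, hp, (Fin.succ_ne_zero _).symm]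
  · cases c
    · simpa using hp' i b
    · simpa using ho' i b
  · simpa using he i j b c

theorem exists_maximal [Fintype V] (H : SimpleGraph V) :
    ∃ (k : ℕ) (e : Fin k → Bool → V), H.IsInducedMatching e ∧
      ¬∃ f : Fin (k + 1) → Bool → V, H.IsInducedMatching f := by
  by_contra! hcon
  have hall : ∀ k, ∃ f : Fin k → Bool → V, H.IsInducedMatching f := by
    intro k
    induction k with
    | zero => exact ⟨Fin.elim0, fun i => i.elim0⟩
    | succ k ih => obtain ⟨e, he⟩ := ih; exact hcon k e he
  obtain ⟨f, hf⟩ := hall (Fintype.card V + 1)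
  have hinj : Function.Injective fun i => f i true := fun i j h => (hf.eq_and_eq h).1
  simpa using Fintype.card_le_of_injective _ hinj

/-- An independent set anticomplete to a transversal of the matching can be enlarged by it. -/
theorem card_add_le (he : H.IsInducedMatching e) {α : ℕ}
    (hα : ∀ S : Finset V, (∀ u ∈ S, ∀ v ∈ S, ¬H.Adj u v) → S.card ≤ α)
    (S : Finset V) (hS : ∀ u ∈ S, ∀ v ∈ S, ¬H.Adj u v) (hSe : ∀ u ∈ S, ∀ i b, u ≠ e i b)
    (σ : Fin k → Bool) (hσ : ∀ u ∈ S, ∀ i, ¬H.Adj u (e i (σ i))) : S.card + k ≤ α := by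
  classical
  have hinj : Function.Injective fun i => e i (σ i) := fun i j h => (he.eq_and_eq h).1
  have hdisj : Disjoint S (Finset.univ.image fun i => e i (σ i)) := by
    rw [Finset.disjoint_right]
    intro v hv hvS
    obtain ⟨i, -, rfl⟩ := Finset.mem_image.1 hv
    exact hSe _ hvS _ _ rfl
  have := hα (S ∪ Finset.univ.image fun i => e i (σ i)) ?_
  · rwa [Finset.card_union_of_disjoint hdisj, Finset.card_image_of_injective _ hinj,
      Finset.card_univ, Fintype.card_fin] at this
  · intro u hu v hv
    simp only [Finset.mem_union, Finset.mem_image, Finset.mem_univ, true_and] at hu hv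
    rcases hu with hu | ⟨i, rfl⟩ <;> rcases hv with hv | ⟨j, rfl⟩
    · exact hS u hu v hv
    · exact hσ u hu j
    · exact fun h => hσ v hv i h.symm
    · rw [he]
      rintro ⟨rfl, h⟩
      exact h rfl

end IsInducedMatching

namespace Attaches

theorem ne_of_adj {s t : V} {σ τ : Fin k → Bool} (hs : H.Attaches e s σ)
    (ht : H.Attaches e t τ) (htri : H.NoTriangle) (h : H.Adj s t) (j : Fin k) : σ j ≠ τ j :=
  fun hj => htri h ((hs j _).2 hj) ((ht j _).2 rfl)

/-- The types of nonadjacent vertices do not differ at three places. -/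
theorem not_three_ne {s t : V} {σ τ : Fin k → Bool} (hs : H.Attaches e s σ)
    (ht : H.Attaches e t τ) (he : H.IsInducedMatching e) (hP : H.NoEdgeWithPath)
    (h : ¬H.Adj s t) {i j l : Fin k} (hij : i ≠ j) (hil : i ≠ l) (hjl : j ≠ l)
    (hi : σ i ≠ τ i) (hj : σ j ≠ τ j) (hl : σ l ≠ τ l) : False := by
  refine hP (u := s) (v := e i (σ i)) (w := t) (a := e j (τ j)) (b := e l (τ l))
    ((hs _ _).2 rfl) ((ht _ _).2 rfl) ((ht _ _).2 rfl) (fun h => hjl (he.eq_and_eq h).1) h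
    (fun h => hj ((hs _ _).1 h)) (fun h => hl ((hs _ _).1 h))
    (fun h => hi ((ht _ _).1 h.symm).symm) ?_ ?_
  · rw [he]; exact fun h => hij h.1
  · rw [he]; exact fun h => hil h.1

/-- Vertices of one type are equal if that type differs at two places from the type of
a vertex adjacent to neither of them. -/
theorem eq_of_two_ne {s t t' : V} {σ τ : Fin k → Bool} (hs : H.Attaches e s σ)
    (ht : H.Attaches e t τ) (ht' : H.Attaches e t' τ) (he : H.IsInducedMatching e)
    (hP : H.NoEdgeWithPath) (h : ¬H.Adj s t) (h' : ¬H.Adj s t') {i j : Fin k} (hij : i ≠ j)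
    (hi : σ i ≠ τ i) (hj : σ j ≠ τ j) : t = t' := by
  by_contra hne
  refine hP (u := s) (v := e i (σ i)) (w := e j (τ j)) (a := t) (b := t')
    ((hs _ _).2 rfl) ((ht _ _).2 rfl).symm ((ht' _ _).2 rfl).symm hne
    (fun h => hj ((hs _ _).1 h)) h h' ?_
    (fun h => hi ((ht _ _).1 h.symm).symm) (fun h => hi ((ht' _ _).1 h.symm).symm)
  rw [he]; exact fun h => hij h.1

end Attaches

theorem bool_three_of_ne {f g : Fin 3 → Bool}
    (hp : (f 0 ^^ f 1 ^^ f 2) = (g 0 ^^ g 1 ^^ g 2)) (hne : f ≠ g) :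
    (∃ i j, i ≠ j ∧ f i ≠ g i ∧ f j ≠ g j) ∧ ∃ i, f i = g i := by
  have key : ∀ d : Fin 3 → Bool, (d 0 ^^ d 1 ^^ d 2) = false → (∃ i, d i = true) →
      (∃ i j, i ≠ j ∧ d i = true ∧ d j = true) ∧ ∃ i, d i = false := by decide
  have hx : ∀ a b c a' b' c' : Bool, (a ^^ b ^^ c) = (a' ^^ b' ^^ c') →
      ((a ^^ a') ^^ (b ^^ b') ^^ (c ^^ c')) = false := by decide
  have := key (fun i => f i ^^ g i) (hx _ _ _ _ _ _ hp)
  simp only [bne_iff_ne, bne_eq_false_iff_eq] at this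
  exact this (Function.ne_iff.1 hne)

theorem card_bool_three_parity (p : Bool) :
    (Finset.univ.filter fun f : Fin 3 → Bool => (f 0 ^^ f 1 ^^ f 2) = p).card = 4 := by
  revert p; decide

theorem card_bool_four_parity (p : Bool) :
    (Finset.univ.filter fun f : Fin 4 → Bool => (f 0 ^^ f 1 ^^ f 2 ^^ f 3) = p).card = 8 := by
  revert p; decide

/-- A word at distance at most two from both of two antipodal words of length four is at
distance exactly two from them. -/
theorem bool_four_mid {f g : Fin 4 → Bool}
    (h1 : ¬∃ i j l, i ≠ j ∧ i ≠ l ∧ j ≠ l ∧ f i ≠ g i ∧ f j ≠ g j ∧ f l ≠ g l)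
    (h2 : ¬∃ i j l, i ≠ j ∧ i ≠ l ∧ j ≠ l ∧ f i = g i ∧ f j = g j ∧ f l = g l) :
    (∃ i j, i ≠ j ∧ f i ≠ g i ∧ f j ≠ g j) ∧ (∃ i j, i ≠ j ∧ f i = g i ∧ f j = g j) ∧
    (f 0 ^^ f 1 ^^ f 2 ^^ f 3) = (g 0 ^^ g 1 ^^ g 2 ^^ g 3) := by
  have key : ∀ d : Fin 4 → Bool,
      (¬∃ i j l, i ≠ j ∧ i ≠ l ∧ j ≠ l ∧ d i = true ∧ d j = true ∧ d l = true) →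
      (¬∃ i j l, i ≠ j ∧ i ≠ l ∧ j ≠ l ∧ d i = false ∧ d j = false ∧ d l = false) →
      (∃ i j, i ≠ j ∧ d i = true ∧ d j = true) ∧ (∃ i j, i ≠ j ∧ d i = false ∧ d j = false) ∧
      (d 0 ^^ d 1 ^^ d 2 ^^ d 3) = false := by decide
  have hx : ∀ a b c d a' b' c' d' : Bool,
      ((a ^^ a') ^^ (b ^^ b') ^^ (c ^^ c') ^^ (d ^^ d')) = false →
      (a ^^ b ^^ c ^^ d) = (a' ^^ b' ^^ c' ^^ d') := by decide
  obtain ⟨h3, h4, h5⟩ := key (fun i => f i ^^ g i) (by simpa using h1) (by simpa using h2)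
  exact ⟨by simpa using h3, by simpa using h4, hx _ _ _ _ _ _ _ _ h5⟩

/-- Among at least five places some three carry a disagreement or some three an agreement. -/
theorem bool_five {f g : Fin k → Bool} (hk : 5 ≤ k)
    (h1 : ¬∃ i j l, i ≠ j ∧ i ≠ l ∧ j ≠ l ∧ f i ≠ g i ∧ f j ≠ g j ∧ f l ≠ g l)
    (h2 : ¬∃ i j l, i ≠ j ∧ i ≠ l ∧ j ≠ l ∧ f i = g i ∧ f j = g j ∧ f l = g l) : False := by
  have hd : (Finset.univ.filter fun i => f i ≠ g i).card ≤ 2 := by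
    by_contra! h
    obtain ⟨i, j, l, hi, hj, hl, h⟩ := Finset.two_lt_card_iff.1 h
    exact h1 ⟨i, j, l, by simp_all⟩
  have ha : (Finset.univ.filter fun i => f i = g i).card ≤ 2 := by
    by_contra! h
    obtain ⟨i, j, l, hi, hj, hl, h⟩ := Finset.two_lt_card_iff.1 h
    exact h2 ⟨i, j, l, by simp_all⟩
  have := Finset.card_filter_add_card_filter_not (s := (Finset.univ : Finset (Fin k)))
    (fun i => f i = g i)
  simp only [Finset.card_univ, Fintype.card_fin] at this
  simp only [ne_eq] at hd
  omega

/-- The vertices attached to a nonempty matching number at most `2 * α - 2`. -/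
theorem card_add_two_le [Fintype V] {α : ℕ}
    (hα : ∀ S : Finset V, (∀ u ∈ S, ∀ v ∈ S, ¬H.Adj u v) → S.card ≤ α)
    (htri : H.NoTriangle) (he : H.IsInducedMatching e) (i : Fin k) {T : Finset V}
    (hTe : ∀ t ∈ T, ∀ i b, t ≠ e i b) (hT : ∀ t ∈ T, ∃ s, H.Attaches e t s) :
    T.card + 2 ≤ 2 * α := by
  classical
  have hne : e i true ≠ e i false := fun h => by simpa using (he.eq_and_eq h).2
  have hdisj : Disjoint T {e i true, e i false} := by
    rw [Finset.disjoint_left]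
    intro t ht
    simp [hTe t ht]
  have hsub : T ∪ {e i true, e i false} ⊆
      Finset.univ.filter (H.Adj (e i true)) ∪ Finset.univ.filter (H.Adj (e i false)) := by
    intro t ht
    simp only [Finset.mem_union, Finset.mem_insert, Finset.mem_singleton, Finset.mem_filter,
      Finset.mem_univ, true_and] at ht ⊢
    rcases ht with ht | rfl | rfl
    · obtain ⟨s, hs⟩ := hT t ht
      have := (hs i (s i)).2 rfl
      cases h : s i <;> rw [h] at this
      · exact .inr this.symm
      · exact .inl this.symm
    · exact .inr ((he _ _ _ _).2 ⟨rfl, by simp⟩)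
    · exact .inl ((he _ _ _ _).2 ⟨rfl, by simp⟩)
  have hN : ∀ v, (Finset.univ.filter (H.Adj v)).card ≤ α := fun v => hα _ fun u hu w hw =>
    htri (Finset.mem_filter.1 hu).2 (Finset.mem_filter.1 hw).2
  have h1 := (Finset.card_le_card hsub).trans (Finset.card_union_le _ _)
  rw [Finset.card_union_of_disjoint hdisj, Finset.card_pair hne] at h1
  have h2 := hN (e i true)
  have h3 := hN (e i false)
  omega

/-- The vertices of one type number at most `α - k`. -/
theorem card_type_add_le {α : ℕ}
    (hα : ∀ S : Finset V, (∀ u ∈ S, ∀ v ∈ S, ¬H.Adj u v) → S.card ≤ α)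
    (htri : H.NoTriangle) (he : H.IsInducedMatching e) (hk : 0 < k) {S : Finset V}
    (hSe : ∀ t ∈ S, ∀ i b, t ≠ e i b) {s : Fin k → Bool} (hS : ∀ t ∈ S, H.Attaches e t s) :
    S.card + k ≤ α := by
  refine he.card_add_le hα S (fun u hu v hv h => ?_) hSe (fun i => !s i) fun u hu i => ?_
  · exact (hS u hu).ne_of_adj (hS v hv) htri h ⟨0, hk⟩ rfl
  · rw [hS u hu]; simp

/-- For a matching of three edges, a set of vertices with types of one parity has at most
`max 4 (α - 3)` elements. -/
theorem card_parity_le {α : ℕ}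
    (hα : ∀ S : Finset V, (∀ u ∈ S, ∀ v ∈ S, ¬H.Adj u v) → S.card ≤ α)
    (htri : H.NoTriangle) (hP : H.NoEdgeWithPath) {e : Fin 3 → Bool → V}
    (he : H.IsInducedMatching e) {S : Finset V} (hSe : ∀ t ∈ S, ∀ i b, t ≠ e i b)
    {τ : V → Fin 3 → Bool} (hS : ∀ t ∈ S, H.Attaches e t (τ t)) {p : Bool}
    (hp : ∀ t ∈ S, (τ t 0 ^^ τ t 1 ^^ τ t 2) = p) : S.card ≤ 4 ∨ S.card + 3 ≤ α := by
  by_cases hsame : ∀ t ∈ S, ∀ u ∈ S, τ t = τ u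
  · rcases S.eq_empty_or_nonempty with rfl | ⟨t, ht⟩
    · simp
    · exact .inr (card_type_add_le hα htri he (by omega) hSe (s := τ t)
        fun u hu => hsame t ht u hu ▸ hS u hu)
  left
  push Not at hsame
  obtain ⟨t, ht, u, hu, htu⟩ := hsame
  rw [← card_bool_three_parity p]
  refine Finset.card_le_card_of_injOn τ (fun v hv => by simpa using hp v hv) ?_
  intro v hv v' hv' hvv'
  obtain ⟨s, hs, hsv⟩ : ∃ s ∈ S, τ s ≠ τ v := by
    by_cases h : τ t = τ v
    · exact ⟨u, hu, h ▸ htu.symm⟩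
    · exact ⟨t, ht, h⟩
  obtain ⟨⟨i, j, hij, hi, hj⟩, l, hl⟩ :=
    bool_three_of_ne ((hp s hs).trans (hp v hv).symm) hsv
  have hv'' : H.Attaches e v' (τ v) := hvv' ▸ hS v' hv'
  exact (hS s hs).eq_of_two_ne (hS v hv) hv'' he hP
    (fun h => (hS s hs).ne_of_adj (hS v hv) htri h l hl)
    (fun h => (hS s hs).ne_of_adj hv'' htri h l hl) hij hi hj

/-- A graph without triangles and without an induced `P2 ∪ P3` whose independence number is
less than a third of its order has order 16 and independence number 5. -/
theorem NoEdgeWithPath.card_eq_sixteen [Fintype V] {α : ℕ} (hP : H.NoEdgeWithPath)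
    (htri : H.NoTriangle)
    (hα : ∀ S : Finset V, (∀ u ∈ S, ∀ v ∈ S, ¬H.Adj u v) → S.card ≤ α)
    (hlt : 3 * α < Fintype.card V) :
    Fintype.card V = 16 ∧ α = 5 := by
  classical
  obtain ⟨k, e, he, hmax⟩ := IsInducedMatching.exists_maximal H
  obtain ⟨T, hT⟩ : ∃ T : Finset V, ∀ v, v ∈ T ↔
      (∀ i b, v ≠ e i b) ∧ ∃ i b, H.Adj v (e i b) :=
    ⟨Finset.univ.filter fun v => (∀ i b, v ≠ e i b) ∧ ∃ i b, H.Adj v (e i b),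
      fun v => Finset.mem_filter_univ v⟩
  obtain ⟨I, hI⟩ : ∃ I : Finset V, ∀ v, v ∈ I ↔
      (∀ i b, v ≠ e i b) ∧ ∀ i b, ¬H.Adj v (e i b) :=
    ⟨Finset.univ.filter fun v => (∀ i b, v ≠ e i b) ∧ ∀ i b, ¬H.Adj v (e i b),
      fun v => Finset.mem_filter_univ v⟩
  have hn : Fintype.card V ≤ 2 * k + I.card + T.card := by
    have hcov : (Finset.univ : Finset V) ⊆
        Finset.univ.image (fun p : Fin k × Bool => e p.1 p.2) ∪ I ∪ T := by
      intro v _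
      simp only [Finset.mem_union, Finset.mem_image, Finset.mem_univ, true_and, hI, hT,
        Prod.exists]
      by_cases h1 : ∃ i b, e i b = v
      · exact .inl (.inl h1)
      · have h1' : ∀ i b, v ≠ e i b := fun i b h => h1 ⟨i, b, h.symm⟩
        by_cases h2 : ∃ i b, H.Adj v (e i b)
        · exact .inr ⟨h1', h2⟩
        · exact .inl (.inr ⟨h1', fun i b h => h2 ⟨i, b, h⟩⟩)
    have h1 := Finset.card_le_card hcov
    have h2 := Finset.card_union_le
      (Finset.univ.image (fun p : Fin k × Bool => e p.1 p.2) ∪ I) T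
    have h3 := Finset.card_union_le (Finset.univ.image (fun p : Fin k × Bool => e p.1 p.2)) I
    have h4 : (Finset.univ.image (fun p : Fin k × Bool => e p.1 p.2)).card ≤ k * 2 := by
      simpa using Finset.card_image_le (s := (Finset.univ : Finset (Fin k × Bool)))
        (f := fun p => e p.1 p.2)
    rw [Finset.card_univ] at h1
    omega
  have hIind : ∀ u ∈ I, ∀ v ∈ I, ¬H.Adj u v := fun u hu v hv h =>
    hmax (he.extend h ((hI u).1 hu).2 ((hI v).1 hv).2)
  have hIk : I.card + k ≤ α := he.card_add_le hα I hIind (fun u hu => ((hI u).1 hu).1)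
    (fun _ => true) fun u hu i => ((hI u).1 hu).2 i _
  have hTe : ∀ t ∈ T, ∀ i b, t ≠ e i b := fun t ht => ((hT t).1 ht).1
  have hex : ∀ t, ∃ s, t ∈ T → H.Attaches e t s := by
    intro t
    by_cases ht : t ∈ T
    · obtain ⟨i, b, hadj⟩ := ((hT t).1 ht).2
      obtain ⟨s, hs⟩ := he.exists_attaches htri hP (hTe t ht) hadj
      exact ⟨s, fun _ => hs⟩
    · exact ⟨fun _ => true, fun h => absurd h ht⟩
  choose τ hτ using hex
  -- Some two attached vertices are adjacent.
  obtain ⟨a, ha, b, hb, hab⟩ : ∃ a ∈ T, ∃ b ∈ T, H.Adj a b := by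
    by_contra! h
    have := hα T h
    omega
  have hk : 0 < k := by
    obtain ⟨i, -⟩ := ((hT a).1 ha).2
    exact i.pos
  have hT2 := card_add_two_le hα htri he ⟨0, hk⟩ hTe fun t ht => ⟨τ t, hτ t ht⟩
  have hk3 : 3 ≤ k := by omega
  have hopp : ∀ i, τ a i ≠ τ b i := (hτ a ha).ne_of_adj (hτ b hb) htri hab
  have hopp' : ∀ i s, s ≠ τ a i → s = τ b i := by
    have hx : ∀ x y z : Bool, x ≠ y → z ≠ x → z = y := by decide
    exact fun i s hs => hx _ _ _ (hopp i) hs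
  have hclass : ∀ s, (T.filter fun t => τ t = s).card + k ≤ α := fun s =>
    card_type_add_le hα htri he hk (s := s) (fun t ht => hTe t (Finset.mem_filter.1 ht).1)
      fun t ht => (Finset.mem_filter.1 ht).2 ▸ hτ t (Finset.mem_filter.1 ht).1
  have hk1 : 1 + k ≤ α := by
    have h1 := hclass (τ a)
    have : 0 < (T.filter fun t => τ t = τ a).card :=
      Finset.card_pos.2 ⟨a, Finset.mem_filter.2 ⟨ha, rfl⟩⟩
    omega
  have hIk2 : 0 < I.card → 2 + k ≤ α := by
    intro h
    obtain ⟨o, ho⟩ := Finset.card_pos.1 h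
    obtain ⟨c, hc, hoc⟩ : ∃ c ∈ T, ¬H.Adj o c := by
      by_cases h1 : H.Adj o a
      · exact ⟨b, hb, fun h2 => htri h1 h2 hab⟩
      · exact ⟨a, ha, h1⟩
    have hne : o ≠ c := by
      rintro rfl
      obtain ⟨i, b, h1⟩ := ((hT o).1 hc).2
      exact ((hI o).1 ho).2 i b h1
    rw [← Finset.card_pair hne]
    refine he.card_add_le hα _ ?_ ?_ (fun i => !τ c i) ?_
    · simp [hoc, H.adj_comm c o]
    · simp only [Finset.mem_insert, Finset.mem_singleton, forall_eq_or_imp, forall_eq]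
      exact ⟨((hI o).1 ho).1, hTe c hc⟩
    · simp only [Finset.mem_insert, Finset.mem_singleton, forall_eq_or_imp, forall_eq]
      exact ⟨fun i => ((hI o).1 ho).2 i _, fun i => by rw [hτ c hc]; simp⟩
  -- Some type differs from those of `a` and `b`.
  obtain ⟨r, hr, hra, hrb⟩ : ∃ r ∈ T, τ r ≠ τ a ∧ τ r ≠ τ b := by
    by_contra! h
    have hcov : T ⊆ (T.filter fun t => τ t = τ a) ∪ (T.filter fun t => τ t = τ b) := by
      intro t ht
      by_cases h1 : τ t = τ a
      · simp [ht, h1]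
      · simp [ht, h t ht h1]
    have h1 := (Finset.card_le_card hcov).trans (Finset.card_union_le _ _)
    have h2 := hclass (τ a)
    have h3 := hclass (τ b)
    omega
  have hnear : ∀ t ∈ T, τ t ≠ τ a → τ t ≠ τ b → (¬H.Adj t a ∧ ¬H.Adj t b) ∧
      (¬∃ i j l, i ≠ j ∧ i ≠ l ∧ j ≠ l ∧ τ t i ≠ τ a i ∧ τ t j ≠ τ a j ∧ τ t l ≠ τ a l) ∧
      (¬∃ i j l, i ≠ j ∧ i ≠ l ∧ j ≠ l ∧ τ t i = τ a i ∧ τ t j = τ a j ∧ τ t l = τ a l) := by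
    intro t ht hta htb
    have h1 : ¬H.Adj t a := fun h => htb <| funext fun i => hopp' i _ <|
      (hτ t ht).ne_of_adj (hτ a ha) htri h i
    have h2 : ¬H.Adj t b := fun h => hta <| funext fun i => by
      by_contra hne
      exact (hτ t ht).ne_of_adj (hτ b hb) htri h i (hopp' i _ hne)
    refine ⟨⟨h1, h2⟩, ?_, ?_⟩
    · rintro ⟨i, j, l, hij, hil, hjl, hi, hj, hl⟩
      exact (hτ t ht).not_three_ne (hτ a ha) he hP h1 hij hil hjl hi hj hl
    · rintro ⟨i, j, l, hij, hil, hjl, hi, hj, hl⟩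
      exact (hτ t ht).not_three_ne (hτ b hb) he hP h2 hij hil hjl (hi ▸ hopp i)
        (hj ▸ hopp j) (hl ▸ hopp l)
  have hk4 : k ≤ 4 := by
    by_contra! h
    obtain ⟨-, h1, h2⟩ := hnear r hr hra hrb
    exact bool_five h h1 h2
  obtain rfl | rfl : k = 3 ∨ k = 4 := by omega
  · have hpar : ∀ p, (T.filter fun t => (τ t 0 ^^ τ t 1 ^^ τ t 2) = p).card ≤ 4 ∨
        (T.filter fun t => (τ t 0 ^^ τ t 1 ^^ τ t 2) = p).card + 3 ≤ α := fun p =>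
      card_parity_le hα htri hP he (fun t ht => hTe t (Finset.mem_filter.1 ht).1)
        (fun t ht => hτ t (Finset.mem_filter.1 ht).1) fun t ht => (Finset.mem_filter.1 ht).2
    have hsum := Finset.card_filter_add_card_filter_not (s := T)
      (fun t => (τ t 0 ^^ τ t 1 ^^ τ t 2) = true)
    simp only [Bool.not_eq_true] at hsum
    have h1 := hpar true
    have h2 := hpar false
    omega
  · have hT8 : T.card ≤ 8 := by
      have hpar : ∀ t ∈ T,
          (τ t 0 ^^ τ t 1 ^^ τ t 2 ^^ τ t 3) = (τ a 0 ^^ τ a 1 ^^ τ a 2 ^^ τ a 3) := by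
        intro t ht
        by_cases h1 : τ t = τ a
        · rw [h1]
        by_cases h2 : τ t = τ b
        · have hx : ∀ w x y z w' x' y' z' : Bool, w ≠ w' → x ≠ x' → y ≠ y' → z ≠ z' →
              (w' ^^ x' ^^ y' ^^ z') = (w ^^ x ^^ y ^^ z) := by decide
          rw [h2]
          exact hx _ _ _ _ _ _ _ _ (hopp 0) (hopp 1) (hopp 2) (hopp 3)
        · obtain ⟨-, h3, h4⟩ := hnear t ht h1 h2
          exact (bool_four_mid h3 h4).2.2
      rw [← card_bool_four_parity (τ a 0 ^^ τ a 1 ^^ τ a 2 ^^ τ a 3)]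
      refine Finset.card_le_card_of_injOn τ (fun v hv => by simpa using hpar v hv) ?_
      intro u hu v hv huv
      have hv' : H.Attaches e v (τ u) := huv ▸ hτ v hv
      by_cases h1 : τ u = τ a
      · obtain ⟨-, h3, h4⟩ := hnear r hr hra hrb
        obtain ⟨⟨i, j, hij, hi, hj⟩, ⟨l, m, -, hl, -⟩, -⟩ := bool_four_mid h3 h4
        rw [← h1] at hi hj hl
        exact (hτ r hr).eq_of_two_ne (hτ u hu) hv' he hP
          (fun h => (hτ r hr).ne_of_adj (hτ u hu) htri h l hl)
          (fun h => (hτ r hr).ne_of_adj hv' htri h l hl) hij hi hj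
      by_cases h2 : τ u = τ b
      · obtain ⟨-, h3, h4⟩ := hnear r hr hra hrb
        obtain ⟨⟨l, m, -, hl, -⟩, ⟨i, j, hij, hi, hj⟩, -⟩ := bool_four_mid h3 h4
        have hl' : τ r l = τ u l := h2 ▸ hopp' l _ hl
        exact (hτ r hr).eq_of_two_ne (hτ u hu) hv' he hP
          (fun h => (hτ r hr).ne_of_adj (hτ u hu) htri h l hl')
          (fun h => (hτ r hr).ne_of_adj hv' htri h l hl') hij
          (by rw [hi, h2]; exact hopp i) (by rw [hj, h2]; exact hopp j)
      · obtain ⟨⟨h5, -⟩, h3, h4⟩ := hnear u hu h1 h2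
        obtain ⟨⟨h6, -⟩, -⟩ := hnear v hv (huv ▸ h1) (huv ▸ h2)
        obtain ⟨⟨i, j, hij, hi, hj⟩, -⟩ := bool_four_mid h3 h4
        exact (hτ a ha).eq_of_two_ne (hτ u hu) hv' he hP (fun h => h5 h.symm)
          (fun h => h6 h.symm) hij hi.symm hj.symm
    omega

theorem nonempty_paraglider_embedding {G : SimpleGraph V} {u v w a b : V} (huv : u ≠ v)
    (hwa : w ≠ a) (hwb : w ≠ b) (huv' : ¬G.Adj u v) (hwa' : ¬G.Adj w a) (hwb' : ¬G.Adj w b)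
    (uw : G.Adj u w) (ua : G.Adj u a) (ub : G.Adj u b) (vw : G.Adj v w) (va : G.Adj v a)
    (vb : G.Adj v b) (ab : G.Adj a b) : Nonempty (paraglider ↪g G) := by
  refine ⟨⟨⟨![u, a, v, w, b], ?_⟩, ?_⟩⟩
  · intro i j hij
    fin_cases i <;> fin_cases j <;>
      simp [huv, hwa, hwb, huv.symm, hwa.symm, hwb.symm, uw.ne, ua.ne, ub.ne, vw.ne, va.ne,
        vb.ne, ab.ne, uw.ne', ua.ne', ub.ne', vw.ne', va.ne', vb.ne', ab.ne'] at hij ⊢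
  · intro i j
    change G.Adj (![u, a, v, w, b] i) (![u, a, v, w, b] j) ↔ paraglider.Adj i j
    fin_cases i <;> fin_cases j <;>
      simp [paraglider, huv', hwa', hwb', uw, ua, ub, vw, va, vb, ab, uw.symm, ua.symm,
        ub.symm, vw.symm, va.symm, vb.symm, ab.symm, G.adj_comm v u, G.adj_comm a w,
        G.adj_comm b w]

end SimpleGraph

theorem stmt2 {V : Type*} [Fintype V] (G : SimpleGraph V)
    (h3K1 : ∀ a b c : V, a ≠ b → a ≠ c → b ≠ c →
      ¬G.Adj a b → ¬G.Adj a c → ¬G.Adj b c → False)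
    (hpara : ¬ Nonempty (paraglider ↪g G))
    (hlt : 3 * G.cliqueNum < Fintype.card V) :
    Fintype.card V = 16 ∧ G.cliqueNum = 5 := by
  refine NoEdgeWithPath.card_eq_sixteen (H := Gᶜ) ?_ ?_ (fun S hS => ?_) hlt
  · intro u v w a b huv hwa hwb hab huw hua hub hvw hva hvb
    apply hpara
    have hab' : G.Adj a b := by
      by_contra h
      exact h3K1 w a b hwa.ne hwb.ne hab hwa.2 hwb.2 h
    have key : ∀ x y, Gᶜ.Adj x y → ∀ z, ¬Gᶜ.Adj x z → ¬Gᶜ.Adj y z → G.Adj x z := by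
      intro x y hxy z hxz hyz
      have hne : x ≠ z := by rintro rfl; exact hyz hxy.symm
      exact by_contra fun h => hxz ⟨hne, h⟩
    have uw := key u v huv w huw hvw
    have ua := key u v huv a hua hva
    have ub := key u v huv b hub hvb
    have vw := key v u huv.symm w hvw huw
    have va := key v u huv.symm a hva hua
    have vb := key v u huv.symm b hvb hub
    exact nonempty_paraglider_embedding huv.ne hwa.ne hwb.ne huv.2 hwa.2 hwb.2 uw ua ub vw va
      vb hab'
  · intro a b c hab hac hbc
    exact h3K1 a b c hab.ne hac.ne hbc.ne hab.2 hac.2 hbc.2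
  · refine IsClique.card_le_cliqueNum (G := G) (tc := fun u hu v hv huv => ?_)
    by_contra h
    exact hS u hu v hv ⟨huv, h⟩
end

section
/- For every i ∈ {1,...,5} (indices modulo 5), A_i is anticomplete to each of B_{i−1}, B_i and B_{i+1}, and A_i is complete to each of B_{i−2} and B_{i+2}. -/
open SimpleGraph

/-- The disjoint union `P2 ∪ P3`: an edge 0-1 together with a path 2-3-4. -/
def p2p3 : SimpleGraph (Fin 5) :=
  SimpleGraph.fromEdgeSet {s(0,1), s(2,3), s(3,4)}

variable {V : Type*}

/-- `S0` is the vertex set of the induced 5-cycle. -/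
def S0 (v : Fin 5 → V) : Set V := Set.range v

/-- `Aset H v i` is the set of vertices outside `S0` whose neighborhood in `S0`
is exactly `{v i}`. -/
def Aset (H : SimpleGraph V) (v : Fin 5 → V) (i : Fin 5) : Set V :=
  {x | x ∉ S0 v ∧ ∀ j : Fin 5, H.Adj x (v j) ↔ j = i}

/-- `Bset H v i` is the set of vertices outside `S0` whose neighborhood in `S0`
is exactly `{v (i-1), v (i+1)}`. -/
def Bset (H : SimpleGraph V) (v : Fin 5 → V) (i : Fin 5) : Set V :=
  {x | x ∉ S0 v ∧ ∀ j : Fin 5, H.Adj x (v j) ↔ (j = i - 1 ∨ j = i + 1)}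

/-- `S2set H v` is the set of vertices at distance exactly 2 from `S0`: vertices outside `S0`
with no neighbor in `S0` but with a neighbor having a neighbor in `S0`. -/
def S2set (H : SimpleGraph V) (v : Fin 5 → V) : Set V :=
  {x | x ∉ S0 v ∧ (∀ j : Fin 5, ¬ H.Adj x (v j)) ∧
    ∃ y, H.Adj x y ∧ ∃ j : Fin 5, H.Adj y (v j)}

/-- `S` is complete to `T`: every vertex of `S` is adjacent to every vertex of `T`. -/
def Complete (H : SimpleGraph V) (S T : Set V) : Prop := ∀ x ∈ S, ∀ y ∈ T, H.Adj x y

/-- `S` is anticomplete to `T`: there are no edges between `S` and `T`. -/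
def Anticomplete (H : SimpleGraph V) (S T : Set V) : Prop := ∀ x ∈ S, ∀ y ∈ T, ¬ H.Adj x y

/-- `hA` is the number of indices `i` with `A_i` nonempty. -/
noncomputable def hA (H : SimpleGraph V) (v : Fin 5 → V) : ℕ :=
  {i : Fin 5 | (Aset H v i).Nonempty}.ncard

/-- `hB` is the number of indices `i` with `B_i` nonempty. -/
noncomputable def hB (H : SimpleGraph V) (v : Fin 5 → V) : ℕ :=
  {i : Fin 5 | (Bset H v i).Nonempty}.ncard

theorem SimpleGraph.CliqueFree.not_adj_of_common_neighbor {H : SimpleGraph V}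
    (h : H.CliqueFree 3) {x y z : V} (hx : H.Adj x z) (hy : H.Adj y z) : ¬ H.Adj x y := by
  classical
  exact fun hxy => h {x, y, z} (is3Clique_triple_iff.2 ⟨hxy, hx, hy⟩)

/-- An edge `a b` and an induced path `c d e` with no edges between them form an induced
`P2 ∪ P3`. -/
theorem nonempty_p2p3_embedding {H : SimpleGraph V} {a b c d e : V}
    (hab : H.Adj a b) (hcd : H.Adj c d) (hde : H.Adj d e)
    (hce : ¬ H.Adj c e) (hne : c ≠ e)
    (hac : ¬ H.Adj a c) (had : ¬ H.Adj a d) (hae : ¬ H.Adj a e)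
    (hbc : ¬ H.Adj b c) (hbd : ¬ H.Adj b d) (hbe : ¬ H.Adj b e) :
    Nonempty (p2p3 ↪g H) := by
  have nac : a ≠ c := by rintro rfl; exact had hcd
  have nad : a ≠ d := by rintro rfl; exact hac hcd.symm
  have nae : a ≠ e := by rintro rfl; exact had hde.symm
  have nbc : b ≠ c := by rintro rfl; exact hbd hcd
  have nbd : b ≠ d := by rintro rfl; exact hbc hcd.symm
  have nbe : b ≠ e := by rintro rfl; exact hbd hde.symm
  refine ⟨⟨⟨![a, b, c, d, e], ?_⟩, ?_⟩⟩
  · intro i j hij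
    fin_cases i <;> fin_cases j <;>
      simp_all [hab.ne, hab.ne', hcd.ne, hcd.ne', hde.ne, hde.ne', eq_comm]
  · intro i j
    change H.Adj (![a, b, c, d, e] i) (![a, b, c, d, e] j) ↔ p2p3.Adj i j
    fin_cases i <;> fin_cases j <;> simp_all [p2p3, H.adj_comm]

theorem stmt6 {V : Type*} [Fintype V] (H : SimpleGraph V) (v : Fin 5 → V)
    (hinj : Function.Injective v)
    (hC5 : ∀ i j : Fin 5, H.Adj (v i) (v j) ↔ (j = i + 1 ∨ i = j + 1))
    (htriangle : H.CliqueFree 3)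
    (hP2P3 : ¬ Nonempty (p2p3 ↪g H))
    : ∀ i : Fin 5,
      Anticomplete H (Aset H v i) (Bset H v (i - 1)) ∧
      Anticomplete H (Aset H v i) (Bset H v i) ∧
      Anticomplete H (Aset H v i) (Bset H v (i + 1)) ∧
      Complete H (Aset H v i) (Bset H v (i - 2)) ∧
      Complete H (Aset H v i) (Bset H v (i + 2)) := by
  intro i
  refine ⟨?_, ?_, ?_, ?_, ?_⟩ <;> rintro x ⟨-, hx⟩ y ⟨hyS, hy⟩
  · exact htriangle.not_adj_of_common_neighbor ((hx i).2 rfl) ((hy i).2 (by simp))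
  · intro hxy
    refine hP2P3 (nonempty_p2p3_embedding (a := v (i + 2)) (b := v (i + 3)) (c := v i)
      (d := x) (e := y) ?_ ?_ hxy ?_ (fun h => hyS ⟨_, h⟩) ?_ ?_ ?_ ?_ ?_ ?_)
    all_goals simp only [hC5, hx, hy, H.adj_comm _ x, H.adj_comm _ y]
    all_goals
      clear * -
      revert i
      decide
  · exact htriangle.not_adj_of_common_neighbor ((hx i).2 rfl) ((hy i).2 (by simp))
  · by_contra hxy
    refine hP2P3 (nonempty_p2p3_embedding (a := x) (b := v i) (c := v (i + 3))
      (d := v (i + 2)) (e := y) ?_ ?_ ?_ ?_ (fun h => hyS ⟨_, h⟩) ?_ ?_ hxy ?_ ?_ ?_)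
    all_goals simp only [hC5, hx, hy, H.adj_comm _ y]
    all_goals
      clear * -
      revert i
      decide
  · by_contra hxy
    refine hP2P3 (nonempty_p2p3_embedding (a := x) (b := v i) (c := v (i + 2))
      (d := v (i + 3)) (e := y) ?_ ?_ ?_ ?_ (fun h => hyS ⟨_, h⟩) ?_ ?_ hxy ?_ ?_ ?_)
    all_goals simp only [hC5, hx, hy, H.adj_comm _ y]
    all_goals
      clear * -
      revert i
      decide
end

section
/- Suppose S2 ≠ ∅. If either (a) exactly two of the sets B_1,...,B_5 are nonempty and these are B_i and B_{i+2} for some i ∈ {1,...,5} (indices modulo 5), or (b) B_{i−1}, B_i and B_{i+2} are all nonempty for some i ∈ {1,...,5}, then |B_j| ≤ 1 for every j ∈ {1,...,5}, the union B_1 ∪ ... ∪ B_5 is an independent set, and S2 consists of a single vertex z which is adjacent to every vertex of B_1 ∪ ... ∪ B_5. -/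
open SimpleGraph

variable {V : Type*}

section

variable {H : SimpleGraph V} {v : Fin 5 → V}

lemma SimpleGraph.CliqueFree.not_adj_of_common_neighbor_s15 (h : H.CliqueFree 3) {a b c : V}
    (hab : H.Adj a b) (hac : H.Adj a c) : ¬ H.Adj b c := fun hbc => by
  classical
  exact h {a, b, c} (SimpleGraph.is3Clique_triple_iff.2 ⟨hab, hac, hbc⟩)

/-- In a `P2 ∪ P3`-free graph, an edge `ab` and an induced path `cde` are joined by an edge. -/
lemma exists_adj_of_p2p3_free (h : ¬ Nonempty (p2p3 ↪g H)) {a b c d e : V}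
    (hab : H.Adj a b) (hcd : H.Adj c d) (hde : H.Adj d e) (hce : ¬ H.Adj c e) (hne : c ≠ e) :
    H.Adj a c ∨ H.Adj a d ∨ H.Adj a e ∨ H.Adj b c ∨ H.Adj b d ∨ H.Adj b e := by
  by_contra! hn
  obtain ⟨hac, had, hae, hbc, hbd, hbe⟩ := hn
  refine h ⟨⟨⟨![a, b, c, d, e], ?_⟩, ?_⟩⟩
  · have h1 := hab.ne
    have h2 := hcd.ne
    have h3 := hde.ne
    have h4 : a ≠ c := by rintro rfl; exact hbc hab.symm
    have h5 : a ≠ d := by rintro rfl; exact hbd hab.symm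
    have h6 : a ≠ e := by rintro rfl; exact hbe hab.symm
    have h7 : b ≠ c := by rintro rfl; exact hac hab
    have h8 : b ≠ d := by rintro rfl; exact had hab
    have h9 : b ≠ e := by rintro rfl; exact hae hab
    intro i j hij
    fin_cases i <;> fin_cases j <;> simp_all
  · intro i j
    change H.Adj (![a, b, c, d, e] i) (![a, b, c, d, e] j) ↔ p2p3.Adj i j
    fin_cases i <;> fin_cases j <;> simp [p2p3] <;> grind [H.adj_comm]

lemma adj_add_iff_of_mem_Bset {x : V} {i : Fin 5} (hx : x ∈ Bset H v i) (k : Fin 5) :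
    H.Adj x (v (i + k)) ↔ k = 1 ∨ k = 4 := by
  rw [hx.2]
  clear hx
  decide +revert

lemma mem_Bset_of_adj (hC5 : ∀ i j : Fin 5, H.Adj (v i) (v j) ↔ (j = i + 1 ∨ i = j + 1))
    (htri : H.CliqueFree 3) {x : V} (hx : x ∉ S0 v) {i : Fin 5}
    (h1 : H.Adj x (v (i - 1))) (h2 : H.Adj x (v (i + 1))) : x ∈ Bset H v i := by
  refine ⟨hx, fun j => ⟨fun hj => ?_, by rintro (rfl | rfl) <;> assumption⟩⟩
  have n1 := htri.not_adj_of_common_neighbor_s15 h1 hj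
  have n2 := htri.not_adj_of_common_neighbor_s15 h2 hj
  rw [hC5] at n1 n2
  clear hj h1 h2
  decide +revert

/-- Every vertex at distance two from the cycle has a neighbor in some `Bset`. -/
lemma exists_adj_mem_Bset (hinj : Function.Injective v)
    (hC5 : ∀ i j : Fin 5, H.Adj (v i) (v j) ↔ (j = i + 1 ∨ i = j + 1))
    (htri : H.CliqueFree 3) (hfree : ¬ Nonempty (p2p3 ↪g H)) {z : V} (hz : z ∈ S2set H v) :
    ∃ i, ∃ y ∈ Bset H v i, H.Adj z y := by
  obtain ⟨-, hzv, y, hzy, j, hyj⟩ := hz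
  have hy : y ∉ S0 v := by
    rintro ⟨k, rfl⟩
    exact hzv k hzy
  have hn1 : ¬ H.Adj y (v (j + 1)) := fun h =>
    htri.not_adj_of_common_neighbor_s15 hyj h ((hC5 _ _).2 (Or.inl rfl))
  have hn4 : ¬ H.Adj y (v (j + 4)) := fun h =>
    htri.not_adj_of_common_neighbor_s15 hyj h ((hC5 _ _).2 (by clear * -; decide +revert))
  by_cases h2 : H.Adj y (v (j + 2))
  · refine ⟨j + 1, y, mem_Bset_of_adj hC5 htri hy ?_ ?_, hzy⟩
    · simpa using hyj
    · rwa [add_assoc]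
  by_cases h3 : H.Adj y (v (j + 3))
  · refine ⟨j + 4, y, mem_Bset_of_adj hC5 htri hy ?_ ?_, hzy⟩
    · rwa [show j + 4 - 1 = j + 3 by clear * -; decide +revert]
    · rwa [show j + 4 + 1 = j by clear * -; decide +revert]
  have := exists_adj_of_p2p3_free hfree hzy
    (c := v (j + 1)) (d := v (j + 2)) (e := v (j + 3))
    ((hC5 _ _).2 (by clear * -; decide +revert)) ((hC5 _ _).2 (by clear * -; decide +revert))
    (by rw [hC5]; clear * -; decide +revert) (hinj.ne (by clear * -; decide +revert))
  simp_all

lemma adj_iff_adj_of_mem_Bset_add_two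
    (hC5 : ∀ i j : Fin 5, H.Adj (v i) (v j) ↔ (j = i + 1 ∨ i = j + 1))
    (htri : H.CliqueFree 3) (hfree : ¬ Nonempty (p2p3 ↪g H)) {z : V} (hz : z ∈ S2set H v)
    {i : Fin 5} {b c : V} (hb : b ∈ Bset H v i) (hc : c ∈ Bset H v (i + 2)) :
    H.Adj z b ↔ H.Adj z c := by
  have hB := adj_add_iff_of_mem_Bset hb
  have hC := adj_add_iff_of_mem_Bset hc
  have hbc : ¬ H.Adj b c := htri.not_adj_of_common_neighbor_s15
    ((hB 1).2 (by decide)).symm (by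
      have := (hC 4).2 (by decide)
      rwa [add_assoc, show (2 : Fin 5) + 4 = 1 by decide, H.adj_comm] at this)
  have hc0 : ¬ H.Adj c (v i) := by
    have := (hC 3).not.2 (by decide)
    rwa [add_assoc, show (2 : Fin 5) + 3 = 0 by decide, add_zero] at this
  have hc2 : ¬ H.Adj c (v (i + 2)) := by
    have := (hC 0).not.2 (by decide)
    rwa [add_zero] at this
  have hc3 : H.Adj c (v (i + 3)) := by
    have := (hC 1).2 (by decide)
    rwa [add_assoc] at this
  have hc4 : ¬ H.Adj c (v (i + 4)) := by
    have := (hC 2).not.2 (by decide)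
    rwa [add_assoc] at this
  have hb0 : ¬ H.Adj b (v i) := by
    have := (hB 0).not.2 (by decide)
    rwa [add_zero] at this
  have hb2 := (hB 2).not.2 (by decide)
  have hb3 := (hB 3).not.2 (by decide)
  have hb4 := (hB 4).2 (by decide)
  have hzv := hz.2.1
  constructor <;> intro h <;> by_contra hn
  · have := exists_adj_of_p2p3_free hfree h ((hC5 (i + 2) (i + 3)).2 (by clear * -; decide +revert))
      hc3.symm (fun h => hc2 h.symm) (fun h => hc.1 ⟨_, h⟩)
    simp_all
  · have := exists_adj_of_p2p3_free hfree h ((hC5 i (i + 4)).2 (by clear * -; decide +revert))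
      hb4.symm (fun h => hb0 h.symm) (fun h => hb.1 ⟨_, h⟩)
    have := H.adj_comm b c
    simp_all

/-- No induced path on three vertices lies in `Bset H v i ∪ S2set H v`, since the edge
`v (i + 2)`, `v (i + 3)` of the cycle is anticomplete to that set. -/
lemma eq_of_adj_of_adj (hC5 : ∀ i j : Fin 5, H.Adj (v i) (v j) ↔ (j = i + 1 ∨ i = j + 1))
    (htri : H.CliqueFree 3) (hfree : ¬ Nonempty (p2p3 ↪g H)) {i : Fin 5} {a b c : V}
    (ha : a ∈ Bset H v i ∪ S2set H v) (hb : b ∈ Bset H v i ∪ S2set H v)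
    (hc : c ∈ Bset H v i ∪ S2set H v) (hab : H.Adj a b) (hbc : H.Adj b c) : a = c := by
  by_contra hne
  have key : ∀ x ∈ Bset H v i ∪ S2set H v, ¬ H.Adj (v (i + 2)) x ∧ ¬ H.Adj (v (i + 3)) x := by
    rintro x (hx | hx)
    · have := adj_add_iff_of_mem_Bset hx
      simp [H.adj_comm _ x, this]
    · simp [H.adj_comm _ x, hx.2.1]
  have := exists_adj_of_p2p3_free hfree ((hC5 (i + 2) (i + 3)).2 (by clear * -; decide +revert))
    hab hbc (htri.not_adj_of_common_neighbor_s15 hab.symm hbc) hne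
  have := key a ha
  have := key b hb
  have := key c hc
  tauto

end

theorem stmt15 {V : Type*} [Fintype V] (H : SimpleGraph V) (v : Fin 5 → V)
    (hinj : Function.Injective v)
    (hC5 : ∀ i j : Fin 5, H.Adj (v i) (v j) ↔ (j = i + 1 ∨ i = j + 1))
    (htriangle : H.CliqueFree 3)
    (hP2P3 : ¬ Nonempty (p2p3 ↪g H))
    (hS2 : (S2set H v).Nonempty)
    (hcase : (∃ i : Fin 5, hB H v = 2 ∧ (Bset H v i).Nonempty ∧ (Bset H v (i + 2)).Nonempty) ∨
      (∃ i : Fin 5, (Bset H v (i - 1)).Nonempty ∧ (Bset H v i).Nonempty ∧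
        (Bset H v (i + 2)).Nonempty))
    : (∀ j : Fin 5, (Bset H v j).ncard ≤ 1) ∧
      (∀ x ∈ ⋃ j : Fin 5, Bset H v j, ∀ y ∈ ⋃ j : Fin 5, Bset H v j, ¬ H.Adj x y) ∧
      (∃ z : V, S2set H v = {z} ∧ ∀ y ∈ ⋃ j : Fin 5, Bset H v j, H.Adj z y) := by
  have step : ∀ {z}, z ∈ S2set H v → ∀ {i j : Fin 5}, j = i + 2 ∨ i = j + 2 →
      ∀ {b c}, b ∈ Bset H v i → c ∈ Bset H v j → H.Adj z b → H.Adj z c := by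
    rintro z hz i j (rfl | rfl) b c hb hc h
    · exact (adj_iff_adj_of_mem_Bset_add_two hC5 htriangle hP2P3 hz hb hc).1 h
    · exact (adj_iff_adj_of_mem_Bset_add_two hC5 htriangle hP2P3 hz hc hb).2 h
  have hcomplete : ∀ z ∈ S2set H v, ∀ j, ∀ y ∈ Bset H v j, H.Adj z y := by
    intro z hz j y hy
    obtain ⟨k, b, hb, hzb⟩ := exists_adj_mem_Bset hinj hC5 htriangle hP2P3 hz
    rcases hcase with ⟨i, hcard, ⟨p, hp⟩, ⟨q, hq⟩⟩ | ⟨i, ⟨o, ho⟩, ⟨p, hp⟩, ⟨q, hq⟩⟩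
    · have hmem : ∀ l, (Bset H v l).Nonempty → l = i ∨ l = i + 2 := by
        have hsub : ({i, i + 2} : Set (Fin 5)) ⊆ {l | (Bset H v l).Nonempty} := by
          rintro l (rfl | rfl)
          exacts [⟨p, hp⟩, ⟨q, hq⟩]
        have heq := Set.eq_of_subset_of_ncard_le hsub
          (hcard.le.trans (Set.ncard_pair (by clear * -; decide +revert)).ge)
        intro l hl
        exact heq.ge hl
      rcases hmem k ⟨b, hb⟩ with rfl | rfl <;> rcases hmem j ⟨y, hy⟩ with rfl | rfl
      · exact step hz (Or.inr rfl) hq hy (step hz (Or.inl rfl) hb hq hzb)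
      · exact step hz (Or.inl rfl) hb hy hzb
      · exact step hz (Or.inr rfl) hb hy hzb
      · exact step hz (Or.inl rfl) hp hy (step hz (Or.inr rfl) hb hp hzb)
    · have hk : ∀ i k : Fin 5, k = i - 1 ∨ k = i ∨ k = i + 1 ∨ k = i + 2 ∨ k = i - 2 := by decide
      have d1 : i - 1 = i + 2 + 2 := by clear * -; decide +revert
      have hpqo : H.Adj z p ∧ H.Adj z q ∧ H.Adj z o := by
        have hpq : H.Adj z p ↔ H.Adj z q := ⟨step hz (by simp) hp hq, step hz (by simp) hq hp⟩
        have hoq : H.Adj z o ↔ H.Adj z q :=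
          ⟨step hz (Or.inr d1) ho hq, step hz (Or.inl d1) hq ho⟩
        suffices H.Adj z p ∨ H.Adj z q ∨ H.Adj z o by tauto
        rcases hk i k with rfl | rfl | rfl | rfl | rfl
        · exact .inr (.inl (step hz (Or.inr d1) hb hq hzb))
        · exact .inr (.inl (step hz (Or.inl rfl) hb hq hzb))
        · exact .inr (.inr (step hz (Or.inr (by clear * -; decide +revert)) hb ho hzb))
        · exact .inl (step hz (Or.inr rfl) hb hp hzb)
        · exact .inl (step hz (Or.inl (by clear * -; decide +revert)) hb hp hzb)
      obtain ⟨hzp, hzq, hzo⟩ := hpqo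
      rcases hk i j with rfl | rfl | rfl | rfl | rfl
      · exact step hz (Or.inl d1) hq hy hzq
      · exact step hz (Or.inr rfl) hq hy hzq
      · exact step hz (Or.inl (by clear * -; decide +revert)) ho hy hzo
      · exact step hz (Or.inl rfl) hp hy hzp
      · exact step hz (Or.inr (by clear * -; decide +revert)) hp hy hzp
  have hex : ∃ i, (Bset H v i).Nonempty := by
    rcases hcase with ⟨i, -, h, -⟩ | ⟨i, h, -⟩
    exacts [⟨_, h⟩, ⟨_, h⟩]
  obtain ⟨z, hz⟩ := hS2
  obtain ⟨i, b, hb⟩ := hex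
  simp only [Set.mem_iUnion]
  refine ⟨fun j => (Set.ncard_le_one_iff (Set.toFinite _)).2 fun {x y} hx hy => ?_, ?_, z, ?_, ?_⟩
  · exact eq_of_adj_of_adj hC5 htriangle hP2P3 (.inl hx) (.inr hz) (.inl hy)
      (hcomplete z hz j x hx).symm (hcomplete z hz j y hy)
  · rintro x ⟨j, hx⟩ y ⟨k, hy⟩
    exact htriangle.not_adj_of_common_neighbor_s15 (hcomplete z hz j x hx) (hcomplete z hz k y hy)
  · refine Set.eq_singleton_iff_unique_mem.2 ⟨hz, fun w hw => ?_⟩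
    exact eq_of_adj_of_adj hC5 htriangle hP2P3 (.inr hw) (.inl hb) (.inr hz)
      (hcomplete w hw i b hb) (hcomplete z hz i b hb).symm
  · rintro y ⟨j, hy⟩
    exact hcomplete z hz j y hy
end
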